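/- There exists a constant C > 0 such that for every integer n ≥ 7 one has Δ_{6,6}(n) ≤ C · n^{−1.676}; equivalently, every n-element subset of [0,1]^6 contains 7 points spanning a 6-dimensional simplex of volume at most C · n^{−1.676}. -/

import Mathlib

open scoped RealInnerProductSpace

/-- The Gram matrix of a collection of `k` vectors in `ℝ^d`. -/
noncomputable def gram {d k : ℕ} (v : Fin k → EuclideanSpace ℝ (Fin d)) :
    Matrix (Fin k) (Fin k) ℝ :=
  Matrix.of fun i j => ⟪v i, v j⟫

/-- `vol v` is the `k`-dimensional volume of the parallelepiped spanned by
`v 1, …, v k`, i.e. the square root of the determinant of their Gram matrix.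
For `k = 0` it equals `1`. -/
noncomputable def vol {d k : ℕ} (v : Fin k → EuclideanSpace ℝ (Fin d)) : ℝ :=
  Real.sqrt (gram v).det

/-- The `k`-dimensional volume of the simplex with vertices `p 0, …, p k`. -/
noncomputable def simplexVol {d k : ℕ} (p : Fin (k + 1) → EuclideanSpace ℝ (Fin d)) : ℝ :=
  (Nat.factorial k : ℝ)⁻¹ * vol (fun i : Fin k => p i.succ - p 0)

/-- The minimum, over all `(k+1)`-element subsets of `X`, of the `k`-dimensional
volume of the simplex they span. -/
noncomputable def minSimplexVol (d k : ℕ) (X : Finset (EuclideanSpace ℝ (Fin d))) : ℝ :=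
  sInf { v : ℝ | ∃ p : Fin (k + 1) → EuclideanSpace ℝ (Fin d),
    Function.Injective p ∧ (∀ i, p i ∈ X) ∧ v = simplexVol p }

/-- `Delta k d n` is the supremum, over all `n`-element subsets `X` of the unit cube
`[0,1]^d`, of the minimum `k`-dimensional simplex volume among `(k+1)`-element
subsets of `X`. -/
noncomputable def Delta (k d n : ℕ) : ℝ :=
  sSup { v : ℝ | ∃ X : Finset (EuclideanSpace ℝ (Fin d)), X.card = n ∧
    (∀ x ∈ X, ∀ i, x i ∈ Set.Icc (0 : ℝ) 1) ∧ v = minSimplexVol d k X }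


/-- The index of the subinterval of length `1 / L` containing `x ∈ [0, 1]`. -/
noncomputable def cell (L : ℕ) (x : ℝ) : Fin (L + 1) :=
  ⟨min ⌊L * x⌋₊ L, by omega⟩

lemma abs_sub_le_of_cell_eq {L : ℕ} (hL : 1 ≤ L) {x y : ℝ} (hx : x ∈ Set.Icc (0 : ℝ) 1)
    (hy : y ∈ Set.Icc (0 : ℝ) 1) (h : cell L x = cell L y) : |x - y| ≤ 1 / L := by
  have hL' : (0 : ℝ) < L := by exact_mod_cast hL
  have key : ∀ z ∈ Set.Icc (0 : ℝ) 1, min ⌊L * z⌋₊ L = ⌊L * z⌋₊ := fun z hz =>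
    min_eq_left (Nat.floor_le_of_le (by nlinarith [hz.2]))
  have h' : ⌊L * x⌋₊ = ⌊L * y⌋₊ := by
    have := congrArg Fin.val h
    simpa only [cell, key x hx, key y hy] using this
  have hx0 := Nat.floor_le (mul_nonneg hL'.le hx.1)
  have hy0 := Nat.floor_le (mul_nonneg hL'.le hy.1)
  have hx1 := Nat.lt_floor_add_one (L * x)
  have hy1 := Nat.lt_floor_add_one (L * y)
  rw [h'] at hx0 hx1
  rw [abs_le, neg_le, le_div_iff₀ hL', le_div_iff₀ hL']
  constructor <;> linarith

lemma exists_grid_size {a n : ℕ} (ha : 1 ≤ a) (hn : 100 * 2 ^ a ≤ n) :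
    ∃ K : ℕ, 1 ≤ K ∧ 100 * (K + 1) ^ a ≤ n ∧ n ≤ (300 * K) ^ a := by
  set K := Nat.findGreatest (fun K => 100 * (K + 1) ^ a ≤ n) n
  have h1 : 1 ≤ K := by
    refine Nat.le_findGreatest ?_ hn
    have : 0 < 2 ^ a := by positivity
    omega
  have h2 : 100 * (K + 1) ^ a ≤ n := by
    refine Nat.findGreatest_spec (P := fun K => 100 * (K + 1) ^ a ≤ n) (m := 1) ?_ hn
    have : 0 < 2 ^ a := by positivity
    omega
  refine ⟨K, h1, h2, ?_⟩
  have h3 : n < 100 * (K + 1 + 1) ^ a := by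
    by_contra! h
    have hle : K + 1 ≤ n := by
      have := Nat.le_self_pow (by omega : a ≠ 0) (K + 1 + 1)
      omega
    have := Nat.le_findGreatest (P := fun K => 100 * (K + 1) ^ a ≤ n) hle h
    omega
  calc n ≤ 100 * (K + 1 + 1) ^ a := h3.le
    _ ≤ 100 ^ a * (3 * K) ^ a := by
      gcongr
      · exact Nat.le_self_pow (by omega) _
      · omega
    _ = (300 * K) ^ a := by rw [← mul_pow]; congr 1; ring

lemma exists_disjoint_triples {α β : Type*} [DecidableEq α] [Fintype β] [DecidableEq β]
    (f : α → β) (m : ℕ) (Y : Finset α) (hY : 2 * Fintype.card β + 3 * m ≤ Y.card) :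
    ∃ t : Fin m → Fin 3 → α, (∀ i k j l, t i k = t j l → i = j ∧ k = l) ∧
      (∀ i k, t i k ∈ Y) ∧ ∀ i k l, f (t i k) = f (t i l) := by
  induction m generalizing Y with
  | zero => exact ⟨Fin.elim0, fun i => i.elim0, fun i => i.elim0, fun i => i.elim0⟩
  | succ m ih =>
    obtain ⟨b, -, hb⟩ := Finset.exists_lt_card_fiber_of_mul_lt_card_of_maps_to
      (s := Y) (t := (Finset.univ : Finset β)) (f := f) (n := 2) (fun _ _ => Finset.mem_univ _)
      (by rw [Finset.card_univ]; omega)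
    obtain ⟨T, hT, hTc⟩ := Finset.exists_subset_card_eq (Nat.succ_le_of_lt hb)
    have hTY : T ⊆ Y := hT.trans (Finset.filter_subset _ _)
    obtain ⟨t, ht1, ht2, ht3⟩ := ih (Y \ T) (by rw [Finset.card_sdiff_of_subset hTY]; omega)
    let e := T.equivFinOfCardEq hTc
    have he : ∀ k, ((e.symm k : T) : α) ∈ T := fun k => (e.symm k).2
    have hnot : ∀ i k, t i k ∉ T := fun i k => (Finset.mem_sdiff.mp (ht2 i k)).2
    refine ⟨Fin.cons (fun k => (e.symm k : α)) t, ?_, ?_, ?_⟩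
    · intro i k j l
      refine Fin.cases ?_ (fun i => ?_) i <;> refine Fin.cases ?_ (fun j => ?_) j
      · intro h
        exact ⟨rfl, e.symm.injective (Subtype.ext h)⟩
      · intro h
        rw [Fin.cons_zero, Fin.cons_succ] at h
        exact absurd (h ▸ he k) (hnot j l)
      · intro h
        rw [Fin.cons_zero, Fin.cons_succ] at h
        exact absurd (h ▸ he l) (hnot i k)
      · intro h
        obtain ⟨rfl, rfl⟩ := ht1 i k j l h
        exact ⟨rfl, rfl⟩
    · intro i k
      refine Fin.cases ?_ (fun i => ?_) i
      · exact hTY (he k)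
      · exact (Finset.mem_sdiff.mp (ht2 i k)).1
    · intro i k l
      refine Fin.cases ?_ (fun i => ?_) i
      · exact (Finset.mem_filter.mp (hT (he k))).2.trans (Finset.mem_filter.mp (hT (he l))).2.symm
      · exact ht3 i k l

lemma add_one_div_two_mem_Icc {x : ℝ} (hx : |x| ≤ 1) : (x + 1) / 2 ∈ Set.Icc (0 : ℝ) 1 := by
  obtain ⟨h1, h2⟩ := abs_le.mp hx
  constructor <;> linarith

lemma abs_sub_le_of_cell_half_eq {L : ℕ} (hL : 1 ≤ L) {x y : ℝ} (hx : |x| ≤ 1) (hy : |y| ≤ 1)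
    (h : cell L ((x + 1) / 2) = cell L ((y + 1) / 2)) : |x - y| ≤ 2 / L := by
  have := abs_sub_le_of_cell_eq hL (add_one_div_two_mem_Icc hx) (add_one_div_two_mem_Icc hy) h
  rw [show (x + 1) / 2 - (y + 1) / 2 = (x - y) / 2 by ring, abs_div, abs_two] at this
  calc |x - y| = 2 * (|x - y| / 2) := by ring
    _ ≤ 2 * (1 / L) := by gcongr
    _ = 2 / L := by ring

lemma exists_almost_parallel {d L m : ℕ} (hL : 1 ≤ L) (hm : (d + 1) * (L + 1) ^ d < m)
    (v : Fin m → Fin (d + 1) → ℝ) (hv : ∀ i, v i ≠ 0) {δ : ℝ} (hδ : ∀ i l, |v i l| ≤ δ) :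
    ∃ i j, i ≠ j ∧ ∃ c : ℝ, ∀ l, |v i l - c * v j l| ≤ δ * (2 / L) := by
  choose q hq using fun i => Finite.exists_max fun l => |v i l|
  have hq0 : ∀ i, v i (q i) ≠ 0 := by
    intro i h
    refine hv i (funext fun l => ?_)
    simpa [h] using hq i l
  have hr : ∀ i l, |v i l / v i (q i)| ≤ 1 := by
    intro i l
    rw [abs_div]
    exact div_le_one_of_le₀ (hq i l) (abs_nonneg _)
  let key : Fin m → Fin (d + 1) × (Fin d → Fin (L + 1)) := fun i =>
    (q i, fun l => cell L ((v i ((q i).succAbove l) / v i (q i) + 1) / 2))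
  obtain ⟨i, j, hij, hk⟩ := Fintype.exists_ne_map_eq_of_card_lt key (by simpa using hm)
  refine ⟨i, j, hij, v i (q i) / v j (q j), fun l => ?_⟩
  have hqe : q i = q j := congrArg Prod.fst hk
  have hke := congrArg Prod.snd hk
  have hclose : |v i l / v i (q i) - v j l / v j (q j)| ≤ 2 / L := by
    rcases Fin.eq_self_or_eq_succAbove (q i) l with h | ⟨l', rfl⟩
    · rw [h, div_self (hq0 i), hqe, div_self (hq0 j), sub_self, abs_zero]
      positivity
    · refine abs_sub_le_of_cell_half_eq hL (hr _ _) (hr _ _) ?_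
      have := congrFun hke l'
      simp only [key] at this
      rw [this, hqe]
  have heq : v i l - v i (q i) / v j (q j) * v j l =
      v i (q i) * (v i l / v i (q i) - v j l / v j (q j)) := by
    have := hq0 i
    have := hq0 j
    field_simp
  rw [heq, abs_mul]
  have hδ0 : 0 ≤ δ := (abs_nonneg _).trans (hδ i (q i))
  gcongr
  exact hδ i (q i)

lemma exists_small_minor {α : Type*} {P : ℕ} (hP : 1 ≤ P) (S : Finset α)
    (hS : 2 * (P + 1) < S.card) (a b : α → ℝ) {R : ℝ} (ha : ∀ x ∈ S, |a x| ≤ R)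
    (hb : ∀ x ∈ S, |b x| ≤ R) :
    ∃ x ∈ S, ∃ y ∈ S, x ≠ y ∧ |a x * b y - a y * b x| ≤ R ^ 2 * (2 / P) := by
  classical
  let key : α → Bool × Fin (P + 1) := fun x =>
    if |b x| ≤ |a x| then (true, cell P ((b x / a x + 1) / 2))
    else (false, cell P ((a x / b x + 1) / 2))
  obtain ⟨x, hx, y, hy, hxy, hk⟩ := Finset.exists_ne_map_eq_of_card_lt_of_maps_to
    (s := S) (t := Finset.univ) (f := key) (by simpa using hS) (fun _ _ => Finset.mem_univ _)
  have main : ∀ u v u' v' : ℝ, |v| ≤ |u| → |v'| ≤ |u'| → |u| ≤ R → |u'| ≤ R →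
      cell P ((v / u + 1) / 2) = cell P ((v' / u' + 1) / 2) →
      |u * v' - u' * v| ≤ R ^ 2 * (2 / P) := by
    intro u v u' v' h h' hu hu' hc
    have hclose := abs_sub_le_of_cell_half_eq hP
      (by rw [abs_div]; exact div_le_one_of_le₀ h (abs_nonneg _))
      (by rw [abs_div]; exact div_le_one_of_le₀ h' (abs_nonneg _)) hc
    have e : ∀ s t : ℝ, |t| ≤ |s| → t = s * (t / s) := by
      intro s t hst
      rcases eq_or_ne s 0 with rfl | hs
      · simpa using hst
      · field_simp
    have heq : u * v' - u' * v = u * u' * -(v / u - v' / u') := by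
      linear_combination u * e u' v' h' - u' * e u v h
    rw [heq, abs_mul, abs_mul, abs_neg, sq]
    have : 0 ≤ R := (abs_nonneg _).trans hu
    gcongr
  refine ⟨x, hx, y, hy, hxy, ?_⟩
  by_cases h : |b x| ≤ |a x| <;> by_cases h' : |b y| ≤ |a y| <;>
    simp only [key, h, h', if_true, if_false, Prod.mk.injEq, reduceCtorEq, false_and, true_and]
      at hk
  · exact main _ _ _ _ h h' (ha x hx) (ha y hy) hk
  · have := main _ _ _ _ (not_le.mp h).le (not_le.mp h').le (hb x hx) (hb y hy) hk
    rw [← abs_neg]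
    convert this using 2
    ring

lemma abs_det_le_of_row_le {k : ℕ} (A : Matrix (Fin k) (Fin k) ℝ) (s : Fin k → ℝ)
    (h : ∀ i j, |A i j| ≤ s i) : |A.det| ≤ k.factorial * ∏ i, s i := by
  rw [Matrix.det_apply]
  refine (Finset.abs_sum_le_sum_abs _ _).trans ?_
  calc ∑ σ : Equiv.Perm (Fin k), |Equiv.Perm.sign σ • ∏ i, A (σ i) i|
      ≤ ∑ _σ : Equiv.Perm (Fin k), ∏ i, s i := by
        refine Finset.sum_le_sum fun σ _ => ?_
        have : |Equiv.Perm.sign σ • ∏ i, A (σ i) i| = ∏ i, |A (σ i) i| := by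
          rw [← Finset.abs_prod]
          rcases Int.units_eq_one_or (Equiv.Perm.sign σ) with h | h <;> simp [h]
        rw [this, ← Equiv.prod_comp σ s]
        exact Finset.prod_le_prod (fun _ _ => abs_nonneg _) fun i _ => h _ _
    _ = k.factorial * ∏ i, s i := by
        simp [Fintype.card_perm]

lemma vol_eq_abs_det {d : ℕ} (v : Fin d → EuclideanSpace ℝ (Fin d)) :
    vol v = |(Matrix.of fun i j => v i j).det| := by
  have : gram v = (Matrix.of fun i j => v i j) * (Matrix.of fun i j => v i j).transpose := by
    ext i j
    simp [gram, Matrix.mul_apply, PiLp.inner_apply, mul_comm]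
  rw [vol, this, Matrix.det_mul, Matrix.det_transpose, Real.sqrt_mul_self_eq_abs]

/-- The determinant, as an alternating map in its rows. -/
noncomputable def euclideanDet (d : ℕ) : EuclideanSpace ℝ (Fin d) [⋀^Fin d]→ₗ[ℝ] ℝ :=
  Matrix.detRowAlternating.compLinearMap (WithLp.linearEquiv 2 ℝ (Fin d → ℝ)).toLinearMap

lemma euclideanDet_apply {d : ℕ} (v : Fin d → EuclideanSpace ℝ (Fin d)) :
    euclideanDet d v = (Matrix.of fun i j => v i j).det := rfl

lemma vol_eq_abs_euclideanDet {d : ℕ} (v : Fin d → EuclideanSpace ℝ (Fin d)) :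
    vol v = |euclideanDet d v| := vol_eq_abs_det v

lemma abs_apply_le_norm {d : ℕ} (x : EuclideanSpace ℝ (Fin d)) (i : Fin d) : |x i| ≤ ‖x‖ :=
  PiLp.norm_apply_le x i

/-- Modulo four vectors in dimension six, every vector is a combination of two unit vectors. -/
lemma exists_complement_pair (r : Fin 4 → EuclideanSpace ℝ (Fin 6))
    (hr : LinearIndependent ℝ r) :
    ∃ f g : EuclideanSpace ℝ (Fin 6), ‖f‖ = 1 ∧ ‖g‖ = 1 ∧
      ∀ x, x - (⟪f, x⟫ • f + ⟪g, x⟫ • g) ∈ Submodule.span ℝ (Set.range r) := by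
  set W := Submodule.span ℝ (Set.range r)
  have hW : Module.finrank ℝ W = 4 := by
    simpa using finrank_span_eq_card hr
  have hWo : Module.finrank ℝ Wᗮ = 2 := by
    have := W.finrank_add_finrank_orthogonal
    simp only [finrank_euclideanSpace, Fintype.card_fin] at this
    omega
  let o := (stdOrthonormalBasis ℝ Wᗮ).reindex (finCongr hWo)
  refine ⟨o 0, o 1, o.norm_eq_one 0, o.norm_eq_one 1, fun x => ?_⟩
  have h := W.starProjection_add_starProjection_orthogonal x
  have h2 := o.orthogonalProjectionOnto_apply_eq_sum x
  rw [Fin.sum_univ_two] at h2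
  have h3 := congrArg (Subtype.val) h2
  simp only [Submodule.coe_add, Submodule.coe_smul] at h3
  rw [← h3]
  have : x - ((Wᗮ.orthogonalProjectionOnto x : Wᗮ) : EuclideanSpace ℝ (Fin 6)) =
      W.orthogonalProjectionOnto x := by
    rw [sub_eq_iff_eq_add]
    exact h.symm
  rw [this]
  exact Submodule.coe_mem _

lemma exists_small_extension
    (Φ : EuclideanSpace ℝ (Fin 6) [⋀^Fin 6]→ₗ[ℝ] ℝ) (r : Fin 4 → EuclideanSpace ℝ (Fin 6))
    {P : ℕ} (hP : 1 ≤ P) (S : Finset (EuclideanSpace ℝ (Fin 6))) (hS : 2 * (P + 1) < S.card)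
    (p₀ : EuclideanSpace ℝ (Fin 6)) {R B : ℝ} (hR : ∀ x ∈ S, ‖x - p₀‖ ≤ R)
    (hB : ∀ f g, ‖f‖ ≤ 1 → ‖g‖ ≤ 1 → |Φ ![r 0, r 1, r 2, r 3, f, g]| ≤ B) :
    ∃ x ∈ S, ∃ y ∈ S, x ≠ y ∧
      |Φ ![r 0, r 1, r 2, r 3, x - p₀, y - p₀]| ≤ R ^ 2 * (2 / P) * B := by
  have hB0 : 0 ≤ B := (abs_nonneg _).trans (hB 0 0 (by simp) (by simp))
  by_cases hr : LinearIndependent ℝ r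
  · obtain ⟨f, g, hf, hg, hfg⟩ := exists_complement_pair r hr
    let ψ := (((Φ.curryLeft (r 0)).curryLeft (r 1)).curryLeft (r 2)).curryLeft (r 3)
    have hψ : ∀ x y, ψ ![x, y] = Φ ![r 0, r 1, r 2, r 3, x, y] := fun x y => rfl
    have hadd : ∀ x x' y, ψ ![x + x', y] = ψ ![x, y] + ψ ![x', y] := fun x x' y =>
      DFunLike.congr_fun (map_add ψ.curryLeft x x') ![y]
    have hsmul : ∀ (c : ℝ) x y, ψ ![c • x, y] = c * ψ ![x, y] := fun c x y =>
      DFunLike.congr_fun (map_smul ψ.curryLeft c x) ![y]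
    have hswap : ∀ x y, ψ ![x, y] = -ψ ![y, x] := fun x y => by
      have := ψ.map_swap ![y, x] (i := 0) (j := 1) (by decide)
      rw [← this]
      congr 1
      ext i
      fin_cases i <;> rfl
    have hself : ∀ x, ψ ![x, x] = 0 := fun x =>
      ψ.map_eq_zero_of_eq ![x, x] (i := 0) (j := 1) rfl (by decide)
    have hspan : ∀ x ∈ Submodule.span ℝ (Set.range r), ∀ y, ψ ![x, y] = 0 := by
      intro x hx y
      induction hx using Submodule.span_induction with
      | mem x h =>
        obtain ⟨i, rfl⟩ := h
        rw [hψ]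
        refine Φ.map_eq_zero_of_eq _ (i := i.castAdd 2) (j := 4) ?_ ?_ <;> fin_cases i <;>
          first | rfl | decide
      | zero => simpa using hsmul 0 0 y
      | add a b _ _ ha hb => rw [hadd, ha, hb, add_zero]
      | smul c a _ ha => rw [hsmul, ha, mul_zero]
    have hred : ∀ x y, ψ ![x, y] = ⟪f, x⟫ * ψ ![f, y] + ⟪g, x⟫ * ψ ![g, y] := by
      intro x y
      have h := hadd (x - (⟪f, x⟫ • f + ⟪g, x⟫ • g)) (⟪f, x⟫ • f + ⟪g, x⟫ • g) y
      rw [sub_add_cancel, hspan _ (hfg x), hadd, hsmul, hsmul, zero_add] at h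
      exact h
    have hfull : ∀ x y, ψ ![x, y] = (⟪f, x⟫ * ⟪g, y⟫ - ⟪f, y⟫ * ⟪g, x⟫) * ψ ![f, g] := by
      intro x y
      rw [hred x y, hswap f y, hswap g y, hred y f, hred y g, hself, hself, hswap g f]
      ring
    have hin : ∀ e : EuclideanSpace ℝ (Fin 6), ‖e‖ = 1 → ∀ x ∈ S, |⟪e, x - p₀⟫| ≤ R :=
      fun e he x hx => (abs_real_inner_le_norm _ _).trans (by rw [he, one_mul]; exact hR x hx)
    obtain ⟨x, hx, y, hy, hxy, h⟩ := exists_small_minor hP S hS (fun x => ⟪f, x - p₀⟫)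
      (fun x => ⟪g, x - p₀⟫) (hin f hf) (hin g hg)
    refine ⟨x, hx, y, hy, hxy, ?_⟩
    rw [← hψ, hfull, abs_mul]
    exact mul_le_mul h (hB f g hf.le hg.le) (abs_nonneg _) (by positivity)
  · obtain ⟨x, hx, y, hy, hxy⟩ := Finset.one_lt_card.mp (show 1 < S.card by omega)
    refine ⟨x, hx, y, hy, hxy, ?_⟩
    rw [Φ.map_linearDependent, abs_zero]
    · positivity
    · intro h
      refine hr ?_
      have hr' : r = ![r 0, r 1, r 2, r 3, x - p₀, y - p₀] ∘ Fin.castAdd 2 := by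
        funext i
        fin_cases i <;> rfl
      rw [hr']
      exact h.comp _ (Fin.castAdd_injective 4 2)

lemma euclideanDet_row_reduce (a₁ a₂ a₃ a₄ x y : EuclideanSpace ℝ (Fin 6)) (c : ℝ) :
    euclideanDet 6 ![a₁, a₂, a₃, a₄, x, y] =
      euclideanDet 6 ![a₁, a₂ - a₁ - c • a₃, a₃, a₄, x, y] := by
  have h1 : euclideanDet 6 ![a₁, a₂, a₃, a₄, x, y] =
      euclideanDet 6 ![a₁, a₂ - a₁, a₃, a₄, x, y] := by
    rw [euclideanDet_apply, euclideanDet_apply]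
    refine Matrix.det_eq_of_forall_row_eq_smul_add_const
      (Pi.single (1 : Fin 6) (1 : ℝ)) 0 (by simp) ?_
    intro i j
    fin_cases i <;> simp
  rw [h1, euclideanDet_apply, euclideanDet_apply]
  refine Matrix.det_eq_of_forall_row_eq_smul_add_const (Pi.single (1 : Fin 6) c) 2 (by simp) ?_
  intro i j
  fin_cases i <;> simp

lemma norm_le_three {x : EuclideanSpace ℝ (Fin 6)} (hx : ∀ i, |x i| ≤ 1) : ‖x‖ ≤ 3 := by
  rw [EuclideanSpace.norm_eq, Real.sqrt_le_left (by norm_num)]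
  calc ∑ i, ‖x i‖ ^ 2 ≤ ∑ _i : Fin 6, (1 : ℝ) :=
        Finset.sum_le_sum fun i _ => pow_le_one₀ (norm_nonneg _) (hx i)
    _ ≤ 3 ^ 2 := by norm_num

lemma abs_sub_le_one_of_mem_cube {d : ℕ} {x y : EuclideanSpace ℝ (Fin d)}
    (hx : ∀ i, x i ∈ Set.Icc (0 : ℝ) 1) (hy : ∀ i, y i ∈ Set.Icc (0 : ℝ) 1) (i : Fin d) :
    |(x - y) i| ≤ 1 := by
  have h1 := hx i
  have h2 := hy i
  rw [PiLp.sub_apply, abs_le]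
  constructor <;> linarith [h1.1, h1.2, h2.1, h2.2]

lemma simplexVol_nonneg {d k : ℕ} (p : Fin (k + 1) → EuclideanSpace ℝ (Fin d)) :
    0 ≤ simplexVol p := by
  unfold simplexVol vol
  positivity

lemma simplexVol_le_one {d : ℕ} (p : Fin (d + 1) → EuclideanSpace ℝ (Fin d))
    (hp : ∀ i j, p i j ∈ Set.Icc (0 : ℝ) 1) : simplexVol p ≤ 1 := by
  rw [simplexVol, vol_eq_abs_det]
  have := abs_det_le_of_row_le (Matrix.of fun i j => (p (Fin.succ i) - p 0) j) 1
    fun i j => abs_sub_le_one_of_mem_cube (hp _) (hp _) j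
  rw [inv_mul_le_iff₀ (by positivity)]
  simpa using this

lemma exists_small_simplex {K L P : ℕ} (hK : 1 ≤ K) (hL : 1 ≤ L) (hP : 1 ≤ P)
    (X : Finset (EuclideanSpace ℝ (Fin 6))) (hX : ∀ x ∈ X, ∀ i, x i ∈ Set.Icc (0 : ℝ) 1)
    (h1 : 2 * (K + 1) ^ 6 + 3 * (6 * (L + 1) ^ 5 + 1) ≤ X.card)
    (h2 : 2 * (P + 1) + 5 < X.card) :
    ∃ p : Fin 7 → EuclideanSpace ℝ (Fin 6), Function.Injective p ∧ (∀ i, p i ∈ X) ∧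
      simplexVol p ≤ 36 / (K ^ 3 * L * P) := by
  classical
  obtain ⟨t, ht, htX, htf⟩ := exists_disjoint_triples
    (fun x : EuclideanSpace ℝ (Fin 6) => fun i => cell K (x i)) (6 * (L + 1) ^ 5 + 1) X
    (by simpa using h1)
  have hnear : ∀ i k l q, |(t i k - t i l) q| ≤ 1 / K := fun i k l q =>
    abs_sub_le_of_cell_eq hK (hX _ (htX i k) q) (hX _ (htX i l) q) (congrFun (htf i k l) q)
  obtain ⟨i, j, hij, c, hc⟩ := exists_almost_parallel (d := 5) hL (Nat.lt_succ_self _)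
    (fun i q => (t i 0 - t i 1) q) (fun i h => by
      have : t i 0 - t i 1 = 0 := by
        ext q
        exact congrFun h q
      exact absurd (ht _ _ _ _ (sub_eq_zero.mp this)).2 (by decide))
    (δ := 1 / K) (fun i q => hnear i 0 1 q)
  let T : Finset (EuclideanSpace ℝ (Fin 6)) := {t j 0, t i 0, t i 1, t j 1, t j 2}
  have hT : T.card ≤ 5 := Finset.card_le_five
  let r : Fin 4 → EuclideanSpace ℝ (Fin 6) :=
    ![t i 0 - t j 0, t i 1 - t j 0 - (t i 0 - t j 0) - c • (t j 1 - t j 0), t j 1 - t j 0,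
      t j 2 - t j 0]
  have hB : ∀ f g : EuclideanSpace ℝ (Fin 6), ‖f‖ ≤ 1 → ‖g‖ ≤ 1 →
      |euclideanDet 6 ![r 0, r 1, r 2, r 3, f, g]| ≤ 1440 / (K ^ 3 * L) := by
    intro f g hf hg
    rw [euclideanDet_apply]
    refine (abs_det_le_of_row_le _ ![1, 1 / K * (2 / L), 1 / K, 1 / K, 1, 1] ?_).trans ?_
    · intro k q
      fin_cases k
      · exact abs_sub_le_one_of_mem_cube (hX _ (htX _ _)) (hX _ (htX _ _)) q
      · refine le_trans (le_of_eq ?_) (hc q)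
        rw [← abs_neg]
        congr 1
        simp [r]
        ring
      · exact hnear j 1 0 q
      · exact hnear j 2 0 q
      · exact (abs_apply_le_norm f q).trans hf
      · exact (abs_apply_le_norm g q).trans hg
    · simp only [Fin.prod_univ_six]
      refine le_of_eq ?_
      simp [Nat.factorial]
      field_simp
      norm_num
  obtain ⟨x, hx, y, hy, hxy, hdet⟩ := exists_small_extension (euclideanDet 6) r hP (X \ T)
    (by have := Finset.le_card_sdiff T X; omega) (t j 0) (R := 3)
    (fun x hx => norm_le_three fun q => abs_sub_le_one_of_mem_cube
      (hX _ (Finset.mem_sdiff.mp hx).1) (hX _ (htX _ _)) q) hB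
  obtain ⟨hxX, hxT⟩ := Finset.mem_sdiff.mp hx
  obtain ⟨hyX, hyT⟩ := Finset.mem_sdiff.mp hy
  simp only [T, Finset.mem_insert, Finset.mem_singleton, not_or] at hxT hyT
  have hne : ∀ a k b l, ¬(a = b ∧ k = l) → t a k ≠ t b l := fun a k b l h e => h (ht _ _ _ _ e)
  refine ⟨![t j 0, t i 0, t i 1, t j 1, t j 2, x, y], ?_, ?_, ?_⟩
  · rw [← List.nodup_ofFn]
    simp [List.ofFn_succ, hxy, hne, hij, hij.symm, Ne.symm hxT.1, Ne.symm hxT.2.1,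
      Ne.symm hxT.2.2.1, Ne.symm hxT.2.2.2.1, Ne.symm hxT.2.2.2.2, Ne.symm hyT.1, Ne.symm hyT.2.1,
      Ne.symm hyT.2.2.1, Ne.symm hyT.2.2.2.1, Ne.symm hyT.2.2.2.2]
  · intro k
    fin_cases k
    exacts [htX _ _, htX _ _, htX _ _, htX _ _, htX _ _, hxX, hyX]
  · have hrows : (fun k : Fin 6 => (![t j 0, t i 0, t i 1, t j 1, t j 2, x, y] :
        Fin 7 → EuclideanSpace ℝ (Fin 6)) k.succ -
        (![t j 0, t i 0, t i 1, t j 1, t j 2, x, y] : Fin 7 → EuclideanSpace ℝ (Fin 6)) 0) =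
        ![t i 0 - t j 0, t i 1 - t j 0, t j 1 - t j 0, t j 2 - t j 0, x - t j 0, y - t j 0] := by
      funext k
      fin_cases k <;> rfl
    rw [simplexVol, hrows, vol_eq_abs_euclideanDet, euclideanDet_row_reduce _ _ _ _ _ _ c,
      inv_mul_le_iff₀ (by positivity)]
    simp only [r, Matrix.cons_val] at hdet
    have hval : (3 : ℝ) ^ 2 * (2 / P) * (1440 / (K ^ 3 * L)) =
        Nat.factorial 6 * (36 / (K ^ 3 * L * P)) := by
      simp [Nat.factorial]
      field_simp
      norm_num
    rw [← hval]
    exact hdet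

lemma minSimplexVol_le {d k : ℕ} {X : Finset (EuclideanSpace ℝ (Fin d))}
    {p : Fin (k + 1) → EuclideanSpace ℝ (Fin d)} (hp : Function.Injective p)
    (hpX : ∀ i, p i ∈ X) : minSimplexVol d k X ≤ simplexVol p :=
  csInf_le ⟨0, by rintro _ ⟨q, -, -, rfl⟩; exact simplexVol_nonneg q⟩ ⟨p, hp, hpX, rfl⟩

lemma exists_simplexVol_le_rpow {n : ℕ} (hn : 7 ≤ n) (X : Finset (EuclideanSpace ℝ (Fin 6)))
    (hXn : X.card = n) (hX : ∀ x ∈ X, ∀ i, x i ∈ Set.Icc (0 : ℝ) 1) :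
    ∃ p : Fin 7 → EuclideanSpace ℝ (Fin 6), Function.Injective p ∧ (∀ i, p i ∈ X) ∧
      simplexVol p ≤ 36 * 300 ^ 5 * (n : ℝ) ^ (-(17 / 10) : ℝ) := by
  have hn0 : (0 : ℝ) < n := by exact_mod_cast (by omega : 0 < n)
  rcases lt_or_ge n 6400 with hsmall | hlarge
  · obtain ⟨Y, hYX, hY⟩ := Finset.exists_subset_card_eq (hXn ▸ hn : 7 ≤ X.card)
    let e := Y.equivFinOfCardEq hY
    have he : ∀ i, (e.symm i : EuclideanSpace ℝ (Fin 6)) ∈ X := fun i => hYX (e.symm i).2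
    refine ⟨fun i => e.symm i, Subtype.val_injective.comp e.symm.injective, he, ?_⟩
    refine (simplexVol_le_one _ fun i j => hX _ (he i) j).trans ?_
    rw [Real.rpow_neg hn0.le, ← div_eq_mul_inv, le_div_iff₀ (by positivity), one_mul]
    calc (n : ℝ) ^ (17 / 10 : ℝ) ≤ (n : ℝ) ^ (2 : ℝ) :=
          Real.rpow_le_rpow_of_exponent_le (by exact_mod_cast (by omega : 1 ≤ n)) (by norm_num)
      _ = (n : ℝ) ^ 2 := Real.rpow_two _
      _ ≤ 6400 ^ 2 := by gcongr; exact_mod_cast hsmall.le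
      _ ≤ 36 * 300 ^ 5 := by norm_num
  · obtain ⟨K, hK, hK1, hK2⟩ := exists_grid_size (a := 6) (n := n) (by norm_num) (by omega)
    obtain ⟨L, hL, hL1, hL2⟩ := exists_grid_size (a := 5) (n := n) (by norm_num) (by omega)
    obtain ⟨P, hP, hP1, hP2⟩ := exists_grid_size (a := 1) (n := n) (by norm_num) (by omega)
    have hP1' : 100 * (P + 1) ≤ n := by simpa using hP1
    obtain ⟨p, hp, hpX, hvol⟩ := exists_small_simplex hK hL hP X hX (by omega) (by omega)
    refine ⟨p, hp, hpX, hvol.trans ?_⟩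
    have root : ∀ (a M : ℕ) (s : ℝ), 0 ≤ s → n ≤ (300 * M) ^ a →
        (n : ℝ) ^ s ≤ (300 * M : ℝ) ^ (a * s) := by
      intro a M s hs h
      rw [Real.rpow_mul (by positivity), Real.rpow_natCast]
      exact Real.rpow_le_rpow hn0.le (by exact_mod_cast h) hs
    have r6 := root 6 K (1 / 2) (by norm_num) hK2
    have r5 := root 5 L (1 / 5) (by norm_num) hL2
    have r1 := root 1 P 1 (by norm_num) hP2
    norm_num at r6 r5 r1
    have hpow : (n : ℝ) ^ (17 / 10 : ℝ) ≤ 300 ^ 5 * (K ^ 3 * L * P) := by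
      calc (n : ℝ) ^ (17 / 10 : ℝ)
          = (n : ℝ) ^ (1 / 2 : ℝ) * (n : ℝ) ^ (1 / 5 : ℝ) * n := by
            rw [← Real.rpow_add hn0, ← Real.rpow_add_one hn0.ne']
            norm_num
        _ ≤ (300 * K) ^ 3 * (300 * L) * (300 * P) := by
            norm_num
            gcongr
        _ = 300 ^ 5 * (K ^ 3 * L * P) := by ring
    have hKLP : (0 : ℝ) < K ^ 3 * L * P := by positivity
    rw [Real.rpow_neg hn0.le, ← div_eq_mul_inv, div_le_div_iff₀ hKLP (by positivity)]
    linarith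

/-- **Corollary 2 (case d = 6).** There is a constant `C > 0` such that for every
`n ≥ 7` one has `Δ_{6,6}(n) ≤ C · n^(-1.676)`: every `n`-element subset of `[0,1]^6`
contains 7 points spanning a simplex of 6-dimensional volume at most `C · n^(-1.676)`. -/
theorem delta_six_six :
    ∃ C : ℝ, 0 < C ∧ ∀ n : ℕ, 7 ≤ n →
      Delta 6 6 n ≤ C * (n : ℝ) ^ ((-1.676 : ℝ)) := by
  refine ⟨36 * 300 ^ 5, by norm_num, fun n hn => ?_⟩
  refine Real.sSup_le ?_ (by positivity)
  rintro _ ⟨X, hXn, hX, rfl⟩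
  obtain ⟨p, hp, hpX, hvol⟩ := exists_simplexVol_le_rpow hn X hXn hX
  refine (minSimplexVol_le hp hpX).trans (hvol.trans ?_)
  gcongr
  · exact_mod_cast (by omega : 1 ≤ n)
  · norm_num
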